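/- arXiv:2105.07737 — 2 statements merged into one kernel-verified Lean document; each statement's English description precedes it below -/
import Mathlib

section
/- The map (r, θ) ↦ Φ_θ(r) is continuous on (0, ∞) × (0, π/2); moreover Φ_θ(r) = 0 for all 0 < r ≤ R₁ and all θ ∈ (0, π/2). -/
/-- The weight function `Φ_θ(r) := inf_{t ≥ 0} |Im((1 + i f_θ'(r)) √(1 - t/(r + i f_θ(r))²))|`,
where `f_θ(r) = f(r) tan θ` and the square root is the principal branch (complex power `1/2`). -/
noncomputable def Phi (f f' : ℝ → ℝ) (θ r : ℝ) : ℝ :=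
  ⨅ t : {t : ℝ // 0 ≤ t},
    |(((1 : ℂ) + Complex.I * ((f' r * Real.tan θ : ℝ) : ℂ)) *
        (((1 : ℂ) - ((t : ℝ) : ℂ) / (((r : ℝ) : ℂ) + Complex.I * ((f r * Real.tan θ : ℝ) : ℂ)) ^ 2)
          ^ ((1 : ℂ) / 2))).im|

open Complex in
/-- The principal square root has nonnegative real part. -/
lemma re_cpow_half_nonneg (z : ℂ) : 0 ≤ (z ^ ((1 : ℂ) / 2)).re := by
  rcases eq_or_ne z 0 with rfl | hz
  · simp
  · have him : (log z * (1 / 2)).im = arg z / 2 := by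
      have : log z * (1 / 2) = ((1 / 2 : ℝ) : ℂ) * log z := by push_cast; ring
      rw [this, im_ofReal_mul, log_im]
      ring
    rw [cpow_def_of_ne_zero hz, exp_re, him]
    refine mul_nonneg (Real.exp_pos _).le (Real.cos_nonneg_of_mem_Icc ⟨?_, ?_⟩)
    · linarith [neg_pi_lt_arg z]
    · linarith [arg_le_pi z]

lemma cpow_half_sq (z : ℂ) : (z ^ ((1 : ℂ) / 2)) ^ 2 = z := by
  rw [one_div]
  exact Complex.cpow_ofNat_inv_pow z 2

lemma one_sub_mul_mem_slitPlane {u : ℂ} (hu : u.im < 0) {t : ℝ} (ht : 0 ≤ t) :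
    1 - (t : ℂ) * u ∈ Complex.slitPlane := by
  rcases ht.eq_or_lt with rfl | ht
  · simp
  · refine Complex.mem_slitPlane_iff.2 (Or.inr ?_)
    simpa using ⟨ht.ne', hu.ne⟩

/-- The integrand of `Phi` in terms of `a = f_θ'(r)` and `u = (r + i f_θ(r))⁻²`. -/
noncomputable def phiIntegrand (a : ℝ) (u : ℂ) (t : ℝ) : ℝ :=
  |((1 + Complex.I * (a : ℂ)) * (1 - (t : ℂ) * u) ^ ((1 : ℂ) / 2)).im|

lemma phiIntegrand_nonneg (a : ℝ) (u : ℂ) (t : ℝ) : 0 ≤ phiIntegrand a u t := abs_nonneg _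

lemma phiIntegrand_zero (a : ℝ) (u : ℂ) : phiIntegrand a u 0 = |a| := by
  simp [phiIntegrand]

lemma Phi_eq_iInf_phiIntegrand (f f' : ℝ → ℝ) (θ r : ℝ) :
    Phi f f' θ r = ⨅ t : {t : ℝ // 0 ≤ t}, phiIntegrand (f' r * Real.tan θ)
      (((r : ℂ) + Complex.I * ((f r * Real.tan θ : ℝ) : ℂ)) ^ 2)⁻¹ t := by
  simp only [Phi, phiIntegrand, div_eq_mul_inv]

lemma bddBelow_range_phiIntegrand {ι : Sort*} (a : ℝ) (u : ℂ) (g : ι → ℝ) :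
    BddBelow (Set.range fun i => phiIntegrand a u (g i)) :=
  ⟨0, by rintro _ ⟨i, rfl⟩; exact phiIntegrand_nonneg _ _ _⟩

lemma Phi_nonneg (f f' : ℝ → ℝ) (θ r : ℝ) : 0 ≤ Phi f f' θ r :=
  Real.iInf_nonneg fun _ => abs_nonneg _

lemma Phi_le (f f' : ℝ → ℝ) (θ r : ℝ) : Phi f f' θ r ≤ |f' r * Real.tan θ| := by
  rw [Phi_eq_iInf_phiIntegrand, ← phiIntegrand_zero]
  exact ciInf_le (bddBelow_range_phiIntegrand _ _ _) (⟨0, le_rfl⟩ : {t : ℝ // 0 ≤ t})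

/-- A bound beyond which `phiIntegrand a u` exceeds its value at `0`. -/
noncomputable def phiCutoff (a : ℝ) (u : ℂ) : ℝ := 1 + 4 * a ^ 2 * (1 + ‖u‖) / u.im ^ 2

lemma one_le_phiCutoff (a : ℝ) (u : ℂ) : 1 ≤ phiCutoff a u := by
  have : 0 ≤ 4 * a ^ 2 * (1 + ‖u‖) / u.im ^ 2 := by positivity
  unfold phiCutoff
  linarith

lemma phiIntegrand_zero_le {a : ℝ} (ha : 0 ≤ a) {u : ℂ} (hu : u.im < 0) {t : ℝ}
    (ht : phiCutoff a u ≤ t) : phiIntegrand a u 0 ≤ phiIntegrand a u t := by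
  have ht1 : 1 ≤ t := (one_le_phiCutoff a u).trans ht
  rw [phiIntegrand_zero, abs_of_nonneg ha, phiIntegrand]
  have hx := re_cpow_half_nonneg (1 - (t : ℂ) * u)
  have hsq := cpow_half_sq (1 - (t : ℂ) * u)
  set w := (1 - (t : ℂ) * u) ^ ((1 : ℂ) / 2)
  have him : 2 * (w.re * w.im) = t * -u.im := by
    have := congrArg Complex.im hsq
    simp [pow_two] at this
    linarith
  have hpos : 0 < w.re * w.im := by nlinarith
  have hre : 0 < w.re := hx.lt_of_ne (by rintro h; simp [← h] at hpos)
  have hy : 0 < w.im := pos_of_mul_pos_right hpos hx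
  have hnorm : w.re ^ 2 ≤ t * (1 + ‖u‖) := by
    have h1 : ‖w‖ ^ 2 ≤ 1 + t * ‖u‖ := by
      rw [← norm_pow, hsq]
      refine (norm_sub_le _ _).trans ?_
      simp [abs_of_nonneg (zero_le_one.trans ht1)]
    have h2 : w.re ^ 2 ≤ ‖w‖ ^ 2 := by
      rw [← sq_abs]
      exact pow_le_pow_left₀ (abs_nonneg _) (Complex.abs_re_le_norm w) 2
    linarith
  have hcut : 4 * a ^ 2 * (1 + ‖u‖) ≤ t * u.im ^ 2 := by
    rw [← div_le_iff₀ (sq_pos_of_neg hu)]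
    unfold phiCutoff at ht
    linarith
  have hle : a ≤ w.im := by
    have h1 : (2 * a * w.re) ^ 2 ≤ (2 * (w.re * w.im)) ^ 2 := by
      rw [him]
      nlinarith [mul_le_mul_of_nonneg_left hnorm (by positivity : 0 ≤ 4 * a ^ 2),
        mul_le_mul_of_nonneg_left hcut (zero_le_one.trans ht1)]
    have h2 := (sq_le_sq₀ (by positivity) (by positivity)).1 h1
    nlinarith
  have : ((1 + Complex.I * (a : ℂ)) * w).im = w.im + a * w.re := by
    simp [add_mul]
  rw [this]
  exact (by nlinarith [mul_nonneg ha hx] : a ≤ w.im + a * w.re).trans (le_abs_self _)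

lemma iInf_phiIntegrand_eq_sInf {a : ℝ} (ha : 0 ≤ a) {u : ℂ} (hu : u.im < 0) :
    ⨅ t : {t : ℝ // 0 ≤ t}, phiIntegrand a u t =
      sInf ((fun s => phiIntegrand a u (s * phiCutoff a u)) '' Set.Icc (0 : ℝ) 1) := by
  have hT : 0 < phiCutoff a u := one_pos.trans_le (one_le_phiCutoff a u)
  have hbdd : BddBelow ((fun s => phiIntegrand a u (s * phiCutoff a u)) '' Set.Icc (0 : ℝ) 1) :=
    ⟨0, by rintro _ ⟨s, -, rfl⟩; exact phiIntegrand_nonneg _ _ _⟩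
  have : Nonempty {t : ℝ // 0 ≤ t} := ⟨⟨0, le_rfl⟩⟩
  apply le_antisymm
  · refine le_csInf ((Set.nonempty_Icc.2 zero_le_one).image _) ?_
    rintro _ ⟨s, hs, rfl⟩
    exact ciInf_le (bddBelow_range_phiIntegrand a u _)
      (⟨s * phiCutoff a u, mul_nonneg hs.1 hT.le⟩ : {t : ℝ // 0 ≤ t})
  · refine le_ciInf fun ⟨t, ht⟩ => ?_
    rcases le_total t (phiCutoff a u) with h | h
    · refine csInf_le hbdd ⟨t / phiCutoff a u, ⟨by positivity, (div_le_one hT).2 h⟩, ?_⟩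
      simp [div_mul_cancel₀ _ hT.ne']
    · refine (csInf_le hbdd ⟨0, by simp, rfl⟩).trans ?_
      simpa using phiIntegrand_zero_le ha hu h

lemma continuousOn_iInf_phiIntegrand :
    ContinuousOn (fun p : ℝ × ℂ => ⨅ t : {t : ℝ // 0 ≤ t}, phiIntegrand p.1 p.2 t)
      {p | 0 ≤ p.1 ∧ p.2.im < 0} := by
  rw [continuousOn_iff_continuous_domRestrict]
  have heq : Set.domRestrict {p : ℝ × ℂ | 0 ≤ p.1 ∧ p.2.im < 0}
      (fun p => ⨅ t : {t : ℝ // 0 ≤ t}, phiIntegrand p.1 p.2 t) =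
      fun p => sInf ((fun s : Set.Icc (0 : ℝ) 1 =>
        phiIntegrand p.1.1 p.1.2 (s * phiCutoff p.1.1 p.1.2)) '' Set.univ) := by
    ext p
    rw [Set.domRestrict_apply, iInf_phiIntegrand_eq_sInf p.2.1 p.2.2, Set.image_univ,
      Set.image_eq_range]
  rw [heq]
  refine isCompact_univ.continuous_sInf ?_
  have hT : Continuous fun p : {p : ℝ × ℂ | 0 ≤ p.1 ∧ p.2.im < 0} =>
      phiCutoff p.1.1 p.1.2 := by
    unfold phiCutoff
    have h0 : ∀ p : {p : ℝ × ℂ | 0 ≤ p.1 ∧ p.2.im < 0}, p.1.2.im ^ 2 ≠ 0 :=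
      fun p => pow_ne_zero 2 p.2.2.ne
    have him : Continuous fun p : {p : ℝ × ℂ | 0 ≤ p.1 ∧ p.2.im < 0} => p.1.2.im :=
      Complex.continuous_im.comp (continuous_snd.comp continuous_subtype_val)
    exact continuous_const.add (Continuous.div (by fun_prop) (him.pow 2) h0)
  refine continuous_abs.comp (Complex.continuous_im.comp (Continuous.mul ?_ ?_))
  · have : Continuous fun x : {p : ℝ × ℂ | 0 ≤ p.1 ∧ p.2.im < 0} × Set.Icc (0 : ℝ) 1 =>
        (x.1.1.1 : ℂ) := by fun_prop
    exact continuous_const.add (continuous_const.mul this)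
  · refine Continuous.cpow ?_ continuous_const ?_
    · have h1 : Continuous fun x : {p : ℝ × ℂ | 0 ≤ p.1 ∧ p.2.im < 0} × Set.Icc (0 : ℝ) 1 =>
          (x.2 : ℝ) * phiCutoff x.1.1.1 x.1.1.2 :=
        (continuous_subtype_val.comp continuous_snd).mul (hT.comp continuous_fst)
      exact continuous_const.sub ((Complex.continuous_ofReal.comp h1).mul (by fun_prop))
    · rintro ⟨p, s⟩
      exact one_sub_mul_mem_slitPlane p.2.2
        (mul_nonneg s.2.1 (zero_le_one.trans (one_le_phiCutoff _ _)))

lemma im_inv_sq_neg {x y : ℝ} (hx : 0 < x) (hy : 0 < y) :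
    (((x : ℂ) + Complex.I * (y : ℂ)) ^ 2)⁻¹.im < 0 := by
  have him : (((x : ℂ) + Complex.I * (y : ℂ)) ^ 2).im = 2 * (x * y) := by
    simp [pow_two]
    ring
  have hne : ((x : ℂ) + Complex.I * (y : ℂ)) ^ 2 ≠ 0 := by
    intro h
    rw [h] at him
    have := mul_pos hx hy
    simp at him
    rcases him with h | h <;> linarith
  rw [Complex.inv_im, him]
  exact div_neg_of_neg_of_pos (by nlinarith [mul_pos hx hy]) (Complex.normSq_pos.2 hne)

theorem phi_continuous_and_vanishing
    (R₁ R₂ : ℝ) (hR₁ : 0 < R₁) (hR₁₂ : R₁ < R₂)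
    (f f' : ℝ → ℝ)
    (hderiv : ∀ r, 0 ≤ r → HasDerivAt f (f' r) r)
    (hf'cont : ContinuousOn f' (Set.Ici 0))
    (hf0 : ∀ r, 0 ≤ r → (f r = 0 ↔ r ≤ R₁))
    (hf'0 : ∀ r, 0 ≤ r → (f' r = 0 ↔ r ≤ R₁))
    (hf'nonneg : ∀ r, 0 ≤ r → 0 ≤ f' r)
    (hflin : ∀ r, R₂ ≤ r → f r = r) :
    ContinuousOn (fun q : ℝ × ℝ => Phi f f' q.2 q.1)
      (Set.Ioi (0 : ℝ) ×ˢ Set.Ioo (0 : ℝ) (Real.pi / 2)) ∧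
    ∀ r : ℝ, 0 < r → r ≤ R₁ → ∀ θ : ℝ, θ ∈ Set.Ioo 0 (Real.pi / 2) →
      Phi f f' θ r = 0 := by
  have hvanish : ∀ r : ℝ, 0 < r → r ≤ R₁ → ∀ θ : ℝ, Phi f f' θ r = 0 := by
    intro r hr hr1 θ
    refine le_antisymm ((Phi_le f f' θ r).trans ?_) (Phi_nonneg f f' θ r)
    simp [(hf'0 r hr.le).2 hr1]
  refine ⟨?_, fun r hr hr1 θ _ => hvanish r hr hr1 θ⟩
  have hfcont : ContinuousOn f (Set.Ici 0) := fun r hr =>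
    (hderiv r hr).continuousAt.continuousWithinAt
  have hmono : MonotoneOn f (Set.Ici 0) := by
    refine monotoneOn_of_deriv_nonneg (convex_Ici 0) hfcont ?_ ?_
    · intro r hr
      exact (hderiv r (interior_subset hr)).differentiableAt.differentiableWithinAt
    · intro r hr
      rw [(hderiv r (interior_subset hr)).deriv]
      exact hf'nonneg r (interior_subset hr)
  have hfpos : ∀ r, R₁ < r → 0 < f r := by
    intro r hr
    have h0 : f R₁ = 0 := (hf0 R₁ hR₁.le).2 le_rfl
    have hle : f R₁ ≤ f r := hmono hR₁.le (hR₁.trans hr).le hr.le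
    exact (h0 ▸ hle).lt_of_ne' fun h => hr.not_ge ((hf0 r (hR₁.trans hr).le).1 h)
  have htan : ContinuousOn Real.tan (Set.Ioo 0 (Real.pi / 2)) :=
    Real.continuousOn_tan_Ioo.mono
      (Set.Ioo_subset_Ioo_left (by linarith [Real.pi_pos]))
  have htan₂ : ∀ q ∈ Set.Ioi (0 : ℝ) ×ˢ Set.Ioo (0 : ℝ) (Real.pi / 2),
      ContinuousAt (fun q : ℝ × ℝ => Real.tan q.2) q := fun q hq =>
    ContinuousAt.comp (g := Real.tan) (htan.continuousAt (isOpen_Ioo.mem_nhds hq.2))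
      continuousAt_snd
  have hf₂ : ∀ q ∈ Set.Ioi (0 : ℝ) ×ˢ Set.Ioo (0 : ℝ) (Real.pi / 2),
      ContinuousAt (fun q : ℝ × ℝ => f q.1 * Real.tan q.2) q := fun q hq =>
    (ContinuousAt.comp (g := f) (hfcont.continuousAt (Ici_mem_nhds hq.1))
      continuousAt_fst).mul (htan₂ q hq)
  have hf'₂ : ∀ q ∈ Set.Ioi (0 : ℝ) ×ˢ Set.Ioo (0 : ℝ) (Real.pi / 2),
      ContinuousAt (fun q : ℝ × ℝ => f' q.1 * Real.tan q.2) q := fun q hq =>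
    (ContinuousAt.comp (g := f') (hf'cont.continuousAt (Ici_mem_nhds hq.1))
      continuousAt_fst).mul (htan₂ q hq)
  intro q hq
  rcases le_or_gt q.1 R₁ with hqR | hqR
  · apply ContinuousAt.continuousWithinAt
    have hlim := (hf'₂ q hq).abs.tendsto
    simp only [(hf'0 q.1 hq.1.le).2 hqR, zero_mul, abs_zero] at hlim
    rw [ContinuousAt, hvanish q.1 hq.1 hqR q.2]
    exact squeeze_zero (fun p => Phi_nonneg f f' p.2 p.1) (fun p => Phi_le f f' p.2 p.1) hlim
  · have hz : ∀ p ∈ Set.Ioi R₁ ×ˢ Set.Ioo (0 : ℝ) (Real.pi / 2),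
        ((((p.1 : ℂ) + Complex.I * ((f p.1 * Real.tan p.2 : ℝ) : ℂ)) ^ 2)⁻¹).im < 0 := fun p hp =>
      im_inv_sq_neg (hR₁.trans hp.1)
        (mul_pos (hfpos p.1 hp.1) (Real.tan_pos_of_pos_of_lt_pi_div_two hp.2.1 hp.2.2))
    have hcont : ContinuousOn (fun p : ℝ × ℝ => Phi f f' p.2 p.1)
        (Set.Ioi R₁ ×ˢ Set.Ioo (0 : ℝ) (Real.pi / 2)) := by
      simp only [Phi_eq_iInf_phiIntegrand]
      refine continuousOn_iInf_phiIntegrand.comp (f := fun p : ℝ × ℝ => (f' p.1 * Real.tan p.2,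
        (((p.1 : ℂ) + Complex.I * ((f p.1 * Real.tan p.2 : ℝ) : ℂ)) ^ 2)⁻¹)) ?_ ?_
      · intro p hp
        have hp' : p ∈ Set.Ioi (0 : ℝ) ×ˢ Set.Ioo (0 : ℝ) (Real.pi / 2) :=
          ⟨hR₁.trans hp.1, hp.2⟩
        refine ContinuousAt.continuousWithinAt
          ((hf'₂ p hp').prodMk (ContinuousAt.inv₀ (ContinuousAt.pow ?_ 2) ?_))
        · exact (Complex.continuous_ofReal.continuousAt.comp continuousAt_fst).add
            (continuousAt_const.mul
              (ContinuousAt.comp (g := Complex.ofReal) Complex.continuous_ofReal.continuousAt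
                (hf₂ p hp')))
        · intro h
          have hneg := hz p hp
          have h0 : ((p.1 : ℂ) + Complex.I * ((f p.1 * Real.tan p.2 : ℝ) : ℂ)) ^ 2 = 0 := h
          rw [h0, inv_zero, Complex.zero_im] at hneg
          exact hneg.false
      · intro p hp
        exact ⟨mul_nonneg (hf'nonneg p.1 (hR₁.trans hp.1).le)
          (Real.tan_pos_of_pos_of_lt_pi_div_two hp.2.1 hp.2.2).le, hz p hp⟩
    exact (hcont.continuousAt
      ((isOpen_Ioi.prod isOpen_Ioo).mem_nhds ⟨hqR, hq.2⟩)).continuousWithinAt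
end

section
/- For every ε ∈ (0, π/4) there exists c > 0 (depending only on ε and f) such that Φ_θ(r) ≥ c for all r > R₁ + ε and all θ with ε ≤ θ ≤ π/2 − ε. -/
open Complex in
/-- If `w` lies in the closed upper half plane, then so does `(1 + i a) √w` for `a ≥ 0`, with a
quantitative bound. -/
theorem min_mul_rpow_norm_le_abs_im {a : ℝ} (ha : 0 ≤ a) {w : ℂ} (hw : 0 ≤ w.im) :
    min 1 a * ‖w‖ ^ (1 / 2 : ℝ) ≤
      |(((1 : ℂ) + I * (a : ℂ)) * w ^ ((1 : ℂ) / 2)).im| := by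
  have hexp : (1 : ℂ) / 2 = ((1 / 2 : ℝ) : ℂ) := by push_cast; rfl
  have harg₀ : 0 ≤ arg w := arg_nonneg_iff.2 hw
  have harg₁ : arg w ≤ Real.pi := arg_le_pi w
  have hre := cpow_ofReal_re w (1 / 2)
  have him := cpow_ofReal_im w (1 / 2)
  have hcos : 0 ≤ Real.cos (arg w * (1 / 2)) :=
    Real.cos_nonneg_of_neg_pi_div_two_le_of_le (by linarith) (by linarith)
  have hsin : 0 ≤ Real.sin (arg w * (1 / 2)) :=
    Real.sin_nonneg_of_nonneg_of_le_pi (by linarith) (by linarith)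
  have hsum : 1 ≤ Real.sin (arg w * (1 / 2)) + Real.cos (arg w * (1 / 2)) := by
    nlinarith [Real.sin_sq_add_cos_sq (arg w * (1 / 2)), mul_nonneg hsin hcos]
  have hmin : 0 ≤ min 1 a := le_min zero_le_one ha
  have hn : 0 ≤ ‖w‖ ^ (1 / 2 : ℝ) := by positivity
  have key : min 1 a ≤ Real.sin (arg w * (1 / 2)) + a * Real.cos (arg w * (1 / 2)) := by
    nlinarith [mul_le_mul_of_nonneg_right (min_le_left 1 a) hsin,
      mul_le_mul_of_nonneg_right (min_le_right 1 a) hcos, mul_le_mul_of_nonneg_left hsum hmin]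
  rw [hexp]
  refine le_trans ?_ (le_abs_self _)
  simp only [mul_im, add_re, add_im, one_re, one_im, I_re, I_im, mul_re, ofReal_re, ofReal_im, hre,
    him]
  nlinarith [mul_le_mul_of_nonneg_right key hn]

open Complex in
/-- The ray `1 - t / (x + i y)²`, `t ≥ 0`, lies in the closed upper half plane when `x, y ≥ 0`. -/
theorem im_one_sub_div_sq_nonneg {x y t : ℝ} (hx : 0 ≤ x) (hy : 0 ≤ y) (ht : 0 ≤ t) :
    0 ≤ ((1 : ℂ) - (t : ℂ) / ((x : ℂ) + I * (y : ℂ)) ^ 2).im := by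
  have him : (((x : ℂ) + I * (y : ℂ)) ^ 2).im = 2 * x * y := by
    simp [pow_two]; ring
  rw [sub_im, div_im, him]
  simp only [one_im, ofReal_im, ofReal_re, zero_mul, zero_div, zero_sub, sub_neg_eq_add,
    zero_add]
  exact div_nonneg (by positivity) (normSq_nonneg _)

open Complex in
/-- The ray `1 - t / (x + i y)²` stays away from the origin. -/
theorem div_le_norm_one_sub_div_sq {x y : ℝ} (hx : 0 < x) (t : ℝ) :
    2 * (y / x) / (1 + (y / x) ^ 2) ≤ ‖(1 : ℂ) - (t : ℂ) / ((x : ℂ) + I * (y : ℂ)) ^ 2‖ := by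
  set z : ℂ := (x : ℂ) + I * (y : ℂ) with hz
  have hzre : z.re = x := by simp [hz]
  have hzim : z.im = y := by simp [hz]
  have hz0 : z ≠ 0 := fun h => by rw [h] at hzre; exact hx.ne hzre
  have him : (z ^ 2 - t).im = 2 * x * y := by
    rw [pow_two, sub_im, mul_im, hzre, hzim, ofReal_im]; ring
  have hnorm : ‖z ^ 2‖ = x ^ 2 + y ^ 2 := by
    rw [norm_pow, Complex.sq_norm, normSq_apply, hzre, hzim]; ring
  have hpos : 0 < x ^ 2 + y ^ 2 := by positivity
  have hq : 2 * (y / x) / (1 + (y / x) ^ 2) = 2 * x * y / (x ^ 2 + y ^ 2) := by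
    field_simp
  rw [one_sub_div (pow_ne_zero 2 hz0), norm_div, hnorm, hq]
  gcongr
  rw [← him]
  exact im_le_norm _

/-- Uniform bounds on `f'` and `f(r) / r` away from the interval where `f` vanishes. -/
theorem exists_uniform_bounds {R₁ R₂ : ℝ} (hR₁ : 0 < R₁) (hR₁₂ : R₁ < R₂) {f f' : ℝ → ℝ}
    (hderiv : ∀ r, 0 ≤ r → HasDerivAt f (f' r) r)
    (hf'cont : ContinuousOn f' (Set.Ici 0))
    (hf0 : ∀ r, 0 ≤ r → (f r = 0 ↔ r ≤ R₁))
    (hf'0 : ∀ r, 0 ≤ r → (f' r = 0 ↔ r ≤ R₁))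
    (hf'nonneg : ∀ r, 0 ≤ r → 0 ≤ f' r)
    (hflin : ∀ r, R₂ ≤ r → f r = r) {ε : ℝ} (hε : 0 < ε) :
    ∃ m M : ℝ, 0 < m ∧ ∀ r, R₁ + ε < r → m ≤ f' r ∧ m ≤ f r / r ∧ f r / r ≤ M := by
  have hcont : ContinuousOn f (Set.Ici 0) := fun r hr =>
    (hderiv r hr).continuousAt.continuousWithinAt
  have hmono : MonotoneOn f (Set.Ici 0) := by
    refine monotoneOn_of_deriv_nonneg (convex_Ici 0) hcont ?_ ?_
    · intro r hr
      rw [interior_Ici] at hr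
      exact (hderiv r hr.le).differentiableAt.differentiableWithinAt
    · intro r hr
      rw [interior_Ici] at hr
      rw [(hderiv r hr.le).deriv]
      exact hf'nonneg r hr.le
  have hf'pos : ∀ r, R₁ < r → 0 < f' r := fun r hr =>
    (hf'nonneg r (by linarith)).lt_of_ne' fun h => hr.not_ge ((hf'0 r (by linarith)).1 h)
  have hfpos : ∀ r, R₁ < r → 0 < f r := fun r hr => by
    have h0 : f R₁ = 0 := (hf0 R₁ hR₁.le).2 le_rfl
    have h1 : f R₁ ≤ f r := hmono hR₁.le (show 0 ≤ r by linarith) hr.le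
    exact (h0 ▸ h1).lt_of_ne' fun h => hr.not_ge ((hf0 r (by linarith)).1 h)
  set K := Set.Icc (R₁ + ε) (R₂ + ε)
  have hKc : IsCompact K := isCompact_Icc
  have hKne : K.Nonempty := Set.nonempty_Icc.2 (by linarith)
  have hK0 : K ⊆ Set.Ici 0 := fun r hr => by
    have := hr.1
    exact Set.mem_Ici.2 (by linarith)
  have hquot : ContinuousOn (fun r => f r / r) K :=
    (hcont.mono hK0).div continuousOn_id fun r hr => by
      have := hr.1
      exact ne_of_gt (show 0 < r by linarith)
  obtain ⟨p, hp, hpmin⟩ := hKc.exists_isMinOn hKne (hf'cont.mono hK0)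
  obtain ⟨q, hq, hqmin⟩ := hKc.exists_isMinOn hKne hquot
  obtain ⟨s, hs, hsmax⟩ := hKc.exists_isMaxOn hKne hquot
  have hp1 : 0 < f' p := hf'pos p (by linarith [hp.1])
  have hq1 : 0 < f q / q := div_pos (hfpos q (by linarith [hq.1])) (by linarith [hq.1])
  refine ⟨min 1 (min (f' p) (f q / q)), max 1 (f s / s), by positivity, fun r hr => ?_⟩
  rcases le_or_gt r R₂ with h | h
  · have hrK : r ∈ K := ⟨hr.le, by linarith⟩
    exact ⟨(min_le_right _ _).trans ((min_le_left _ _).trans (hpmin hrK)),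
      (min_le_right _ _).trans ((min_le_right _ _).trans (hqmin hrK)),
      (hsmax hrK).trans (le_max_right _ _)⟩
  · have hr0 : 0 < r := by linarith
    have hf'1 : f' r = 1 := by
      refine (hderiv r hr0.le).unique ((hasDerivAt_id r).congr_of_eventuallyEq ?_)
      filter_upwards [eventually_gt_nhds h] with x hx using hflin x hx.le
    rw [hf'1, hflin r h.le, div_self hr0.ne']
    exact ⟨min_le_left _ _, min_le_left _ _, le_max_left _ _⟩

theorem phi_uniform_lower_bound
    (R₁ R₂ : ℝ) (hR₁ : 0 < R₁) (hR₁₂ : R₁ < R₂)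
    (f f' : ℝ → ℝ)
    (hderiv : ∀ r, 0 ≤ r → HasDerivAt f (f' r) r)
    (hf'cont : ContinuousOn f' (Set.Ici 0))
    (hf0 : ∀ r, 0 ≤ r → (f r = 0 ↔ r ≤ R₁))
    (hf'0 : ∀ r, 0 ≤ r → (f' r = 0 ↔ r ≤ R₁))
    (hf'nonneg : ∀ r, 0 ≤ r → 0 ≤ f' r)
    (hflin : ∀ r, R₂ ≤ r → f r = r) :
    ∀ ε : ℝ, ε ∈ Set.Ioo 0 (Real.pi / 4) → ∃ c : ℝ, 0 < c ∧
      ∀ r : ℝ, R₁ + ε < r → ∀ θ : ℝ, ε ≤ θ → θ ≤ Real.pi / 2 - ε →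
        c ≤ Phi f f' θ r := by
  rintro ε ⟨hε, hε4⟩
  obtain ⟨m, M, hm, hbound⟩ :=
    exists_uniform_bounds hR₁ hR₁₂ hderiv hf'cont hf0 hf'0 hf'nonneg hflin hε
  set T₀ := Real.tan ε
  set T₁ := Real.tan (Real.pi / 2 - ε)
  have hT₀pos : 0 < T₀ := Real.tan_pos_of_pos_of_lt_pi_div_two hε (by linarith)
  refine ⟨min 1 (m * T₀) * (2 * (m * T₀) / (1 + (M * T₁) ^ 2)) ^ (1 / 2 : ℝ), by positivity, ?_⟩
  intro r hr θ hθ₀ hθ₁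
  obtain ⟨hf'm, hfm, hfM⟩ := hbound r hr
  have hr0 : 0 < r := by linarith
  have hT₀θ : T₀ ≤ Real.tan θ := Real.strictMonoOn_tan.monotoneOn
    ⟨by linarith, by linarith⟩ ⟨by linarith, by linarith⟩ hθ₀
  have hθT₁ : Real.tan θ ≤ T₁ := Real.strictMonoOn_tan.monotoneOn
    ⟨by linarith, by linarith⟩ ⟨by linarith, by linarith⟩ hθ₁
  have hθpos : 0 < Real.tan θ := hT₀pos.trans_le hT₀θ
  have hfpos : 0 < f r := (div_pos_iff_of_pos_right hr0).1 (hm.trans_le hfm)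
  have hquot : f r * Real.tan θ / r = f r / r * Real.tan θ := by ring
  have hquot₀ : m * T₀ ≤ f r * Real.tan θ / r := by rw [hquot]; gcongr
  have hquot₁ : f r * Real.tan θ / r ≤ M * T₁ := by
    rw [hquot]
    have : 0 ≤ M := hm.le.trans (hfm.trans hfM)
    gcongr
  have hquotpos : 0 < f r * Real.tan θ / r := by positivity
  have ha : m * T₀ ≤ f' r * Real.tan θ :=
    mul_le_mul hf'm hT₀θ hT₀pos.le (hm.le.trans hf'm)
  have : Nonempty {t : ℝ // 0 ≤ t} := ⟨⟨0, le_rfl⟩⟩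
  refine le_ciInf fun t => ?_
  refine le_trans ?_ (min_mul_rpow_norm_le_abs_im ((by positivity : 0 ≤ m * T₀).trans ha)
    (im_one_sub_div_sq_nonneg hr0.le (by positivity) t.2))
  have hnorm : 2 * (m * T₀) / (1 + (M * T₁) ^ 2) ≤ _ :=
    le_trans (by gcongr) (div_le_norm_one_sub_div_sq (y := f r * Real.tan θ) hr0 t)
  have ha₀ : 0 ≤ min 1 (f' r * Real.tan θ) :=
    le_min zero_le_one ((by positivity : 0 ≤ m * T₀).trans ha)
  gcongr
end
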